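/- arXiv:1103.1822 — 2 statements merged into one kernel-verified Lean document; each statement's English description precedes it below -/
import Mathlib

section
/- For all real numbers M ≥ 1 and all s, t > 0, one has st/(M + log(e + st)) ≤ e^{t−M} + s. -/
theorem pointwise_log_holder_inequality (M s t : ℝ) (hM : 1 ≤ M) (hs : 0 < s) (ht : 0 < t) :
    s * t / (M + Real.log (Real.exp 1 + s * t)) ≤ Real.exp (t - M) + s := by
  have hst : 0 < s * t := mul_pos hs ht
  have he : 0 < Real.exp 1 := Real.exp_pos 1
  have hL : 1 ≤ Real.log (Real.exp 1 + s * t) := by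
    rw [Real.le_log_iff_exp_le (by linarith)]
    linarith
  have hE : 0 < Real.exp (t - M) := Real.exp_pos _
  rw [div_le_iff₀ (by linarith)]
  by_cases h : t ≤ M + Real.log (Real.exp 1 + s * t)
  · have h1 := mul_le_mul_of_nonneg_left h hs.le
    have h2 : 0 ≤ Real.exp (t - M) * (M + Real.log (Real.exp 1 + s * t)) :=
      mul_nonneg hE.le (by linarith)
    linarith
  · have h1 : Real.exp 1 + s * t ≤ Real.exp (t - M) := by
      rw [← Real.log_le_iff_le_exp (by linarith)]
      linarith
    have h2 : (Real.exp (t - M) + s) * 1 ≤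
        (Real.exp (t - M) + s) * (M + Real.log (Real.exp 1 + s * t)) :=
      mul_le_mul_of_nonneg_left (by linarith) (by linarith)
    linarith
end

section
/- There exists a constant C = C(n) such that for every f ∈ L¹(ℝⁿ) and every g ∈ BMO(ℝⁿ), the pointwise product fg belongs to the Musielak–Orlicz space L^{log}(ℝⁿ), meaning ∫_{ℝⁿ} |f(x)g(x)| / (λ(log(e+|x|) + log(e+|f(x)g(x)|/λ))) dx < ∞ for some λ > 0, and moreover ‖fg‖_{L^{log}} ≤ C ‖f‖_{L¹} ‖g‖_{BMO⁺}. -/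
open MeasureTheory

noncomputable def theta (n : ℕ) (x : EuclideanSpace ℝ (Fin n)) (t : ℝ) : ℝ :=
  t / (Real.log (Real.exp 1 + ‖x‖) + Real.log (Real.exp 1 + t))

def cube (n : ℕ) (c : Fin n → ℝ) (r : ℝ) : Set (EuclideanSpace ℝ (Fin n)) :=
  {x | ∀ i, c i ≤ x i ∧ x i < c i + r}

noncomputable def LlogNorm (n : ℕ) (f : EuclideanSpace ℝ (Fin n) → ℝ) : ℝ :=
  sInf {lam : ℝ | 0 < lam ∧ ∫⁻ x, ENNReal.ofReal (theta n x (|f x| / lam)) ≤ 1}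

namespace JN
open Set Filter Topology
open scoped ENNReal

variable {n : ℕ}

/-- half-open cube in `Fin n → ℝ`. -/
def Q (c : Fin n → ℝ) (r : ℝ) : Set (Fin n → ℝ) :=
  Set.univ.pi fun i => Set.Ico (c i) (c i + r)

lemma mem_Q {c : Fin n → ℝ} {r : ℝ} {x : Fin n → ℝ} :
    x ∈ Q c r ↔ ∀ i, c i ≤ x i ∧ x i < c i + r := by
  simp [Q, Set.mem_pi]

lemma measurableSet_Q (c : Fin n → ℝ) (r : ℝ) : MeasurableSet (Q c r) :=
  MeasurableSet.univ_pi fun _ => measurableSet_Ico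

lemma volume_Q (c : Fin n → ℝ) (r : ℝ) : volume (Q c r) = ENNReal.ofReal r ^ n := by
  rw [Q, Real.volume_pi_Ico]; simp

lemma volume_Q_ne_top (c : Fin n → ℝ) (r : ℝ) : volume (Q c r) ≠ ∞ := by
  rw [volume_Q]; exact ENNReal.pow_ne_top ENNReal.ofReal_ne_top

lemma volume_Q_ne_zero (c : Fin n → ℝ) {r : ℝ} (hr : 0 < r) : volume (Q c r) ≠ 0 := by
  rw [volume_Q]; exact pow_ne_zero _ (by simpa using hr)

lemma volume_Q_half (c c' : Fin n → ℝ) (r : ℝ) :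
    volume (Q c r) = 2 ^ n * volume (Q c' (r / 2)) := by
  rw [volume_Q, volume_Q, ← mul_pow]
  congr 1
  rw [show (2 : ℝ≥0∞) = ENNReal.ofReal 2 by simp, ← ENNReal.ofReal_mul (by norm_num)]
  congr 1; ring

/-- corner of the dyadic child -/
noncomputable def ch (c : Fin n → ℝ) (r : ℝ) (e : Fin n → Bool) : Fin n → ℝ :=
  fun i => if e i then c i + r / 2 else c i

noncomputable def sel (c : Fin n → ℝ) (r : ℝ) (x : Fin n → ℝ) : Fin n → Bool :=
  fun i => decide (c i + r / 2 ≤ x i)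

lemma mem_child {c : Fin n → ℝ} {r : ℝ} {x : Fin n → ℝ} (hx : x ∈ Q c r) :
    x ∈ Q (ch c r (sel c r x)) (r / 2) := by
  rw [mem_Q] at *
  intro i
  have := hx i
  by_cases h : c i + r / 2 ≤ x i
  · simp only [ch, sel, h, decide_true, if_true]; exact ⟨trivial, by linarith⟩
  · simp only [ch, sel, h, decide_false]
    simp; exact ⟨this.1, by linarith⟩

lemma of_mem_child {c : Fin n → ℝ} {r : ℝ} {x : Fin n → ℝ} {e : Fin n → Bool} (hr : 0 < r)
    (hx : x ∈ Q (ch c r e) (r / 2)) : x ∈ Q c r ∧ sel c r x = e := by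
  rw [mem_Q] at *
  constructor
  · intro i
    have := hx i
    unfold ch at this
    split_ifs at this <;> constructor <;> linarith [this.1, this.2]
  · funext i
    have := hx i
    unfold ch at this
    cases h : e i <;> simp only [h, sel] at this ⊢ <;> simp at this ⊢ <;> linarith

lemma Q_eq_iUnion (c : Fin n → ℝ) {r : ℝ} (hr : 0 < r) :
    Q c r = ⋃ e : Fin n → Bool, Q (ch c r e) (r / 2) := by
  ext x
  rw [mem_iUnion]
  exact ⟨fun h => ⟨_, mem_child h⟩, fun ⟨e, h⟩ => (of_mem_child hr h).1⟩

lemma lintegral_split (c : Fin n → ℝ) {r : ℝ} (hr : 0 < r) (F : (Fin n → ℝ) → ℝ≥0∞) :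
    ∫⁻ x in Q c r, F x = ∑ e : Fin n → Bool, ∫⁻ x in Q (ch c r e) (r / 2), F x := by
  rw [Q_eq_iUnion c hr, lintegral_iUnion (fun _ => measurableSet_Q _ _), tsum_fintype]
  intro e e' hne
  refine Set.disjoint_left.2 fun x hx hx' => hne ?_
  rw [← (of_mem_child hr hx).2, (of_mem_child hr hx').2]

/-- dyadic averages -/
noncomputable def E (g : (Fin n → ℝ) → ℝ) : ℕ → (Fin n → ℝ) → ℝ → (Fin n → ℝ) → ℝ
  | 0, c, r, _ => ⨍ y in Q c r, g y
  | j + 1, c, r, x => E g j (ch c r (sel c r x)) (r / 2) x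

lemma measurable_sel (c : Fin n → ℝ) (r : ℝ) : Measurable (sel c r) := by
  refine measurable_pi_lambda _ fun i => ?_
  refine measurable_to_bool ?_
  have : (fun x => sel c r x i) ⁻¹' {true} = {x | c i + r / 2 ≤ x i} := by
    ext x; simp [sel]
  rw [this]
  exact measurableSet_le measurable_const (measurable_pi_apply i)

lemma measurable_E (g : (Fin n → ℝ) → ℝ) (j : ℕ) : ∀ c r, Measurable (E g j c r) := by
  induction j with
  | zero => intro c r; exact measurable_const
  | succ j ih =>
    intro c r
    have : Measurable (fun p : (Fin n → ℝ) × (Fin n → Bool) => E g j (ch c r p.2) (r / 2) p.1) :=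
      measurable_from_prod_countable_left fun e => ih (ch c r e) (r / 2)
    exact this.comp (measurable_id.prodMk (measurable_sel c r))

lemma E_eq (g : (Fin n → ℝ) → ℝ) (j : ℕ) : ∀ c r x, x ∈ Q c r →
    ∃ w, x ∈ Q w (r / 2 ^ j) ∧ E g j c r x = ⨍ y in Q w (r / 2 ^ j), g y := by
  induction j with
  | zero => intro c r x hx; exact ⟨c, by simpa using hx, by simp [E]⟩
  | succ j ih =>
    intro c r x hx
    obtain ⟨w, h1, h2⟩ := ih _ _ x (mem_child hx)
    have : r / 2 ^ (j + 1) = r / 2 / 2 ^ j := by rw [pow_succ]; field_simp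
    rw [this]
    exact ⟨w, h1, h2⟩

lemma integrableOn_Q {g : (Fin n → ℝ) → ℝ} (hg : LocallyIntegrable g) (c : Fin n → ℝ) (r : ℝ) :
    IntegrableOn g (Q c r) := by
  have : IntegrableOn g (Set.Icc c (fun i => c i + r)) :=
    hg.integrableOn_isCompact isCompact_Icc
  refine this.mono_set ?_
  intro x hx
  rw [mem_Q] at hx
  exact ⟨fun i => (hx i).1, fun i => (hx i).2.le⟩

lemma avg_sub_le {g : (Fin n → ℝ) → ℝ} (hg : LocallyIntegrable g) (c : Fin n → ℝ) {r : ℝ}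
    (hr : 0 < r) (a : ℝ) :
    ENNReal.ofReal |(⨍ y in Q c r, g y) - a| * volume (Q c r) ≤ ∫⁻ x in Q c r, ‖g x - a‖ₑ := by
  refine le_trans (le_of_eq ?_) (enorm_integral_le_lintegral_enorm (fun x => g x - a))
  rw [integral_sub (integrableOn_Q hg c r)
    (integrableOn_const (volume_Q_ne_top c r))]
  rw [setAverage_eq]
  have h0 : 0 < volume.real (Q c r) :=
    ENNReal.toReal_pos (volume_Q_ne_zero c hr) (volume_Q_ne_top c r)
  have h1 : volume (Q c r) = ENNReal.ofReal (volume.real (Q c r)) :=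
    (ENNReal.ofReal_toReal (volume_Q_ne_top c r)).symm
  rw [h1, ← ENNReal.ofReal_mul (abs_nonneg _), Real.enorm_eq_ofReal_abs]
  congr 1
  rw [setIntegral_const, ← abs_of_pos h0, ← abs_mul, abs_of_pos h0]
  congr 1
  simp only [smul_eq_mul]
  field_simp

/-- BMO bound in lintegral form. -/
def Bd (g : (Fin n → ℝ) → ℝ) (N : ℝ) : Prop := ∀ (c : Fin n → ℝ) (r : ℝ), 0 < r →
  ∫⁻ x in Q c r, ‖g x - ⨍ y in Q c r, g y‖ₑ ≤ ENNReal.ofReal N * volume (Q c r)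

lemma avg_half {g : (Fin n → ℝ) → ℝ} {N : ℝ} (hg : LocallyIntegrable g) (hN : 0 ≤ N)
    (hb : Bd g N) {c c' : Fin n → ℝ} {r : ℝ} (hr : 0 < r) (hs : Q c' (r / 2) ⊆ Q c r) :
    |(⨍ y in Q c' (r / 2), g y) - ⨍ y in Q c r, g y| ≤ 2 ^ n * N := by
  have h := avg_sub_le hg c' (half_pos hr) (⨍ y in Q c r, g y)
  have h2 := h.trans ((lintegral_mono_set hs).trans (hb c r hr))
  rw [volume_Q_half c c', ← mul_assoc, ENNReal.mul_le_mul_iff_left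
    (volume_Q_ne_zero c' (half_pos hr)) (volume_Q_ne_top _ _)] at h2
  rw [show (2 : ℝ≥0∞) = ENNReal.ofReal 2 by simp, ← ENNReal.ofReal_pow (by norm_num),
    ← ENNReal.ofReal_mul hN, ENNReal.ofReal_le_ofReal_iff (by positivity)] at h2
  linarith

lemma child_subset (c : Fin n → ℝ) {r : ℝ} (hr : 0 < r) (e : Fin n → Bool) :
    Q (ch c r e) (r / 2) ⊆ Q c r := fun _ hx => (of_mem_child hr hx).1

lemma lintegral_E_succ (g : (Fin n → ℝ) → ℝ) (F : ℝ → ℝ≥0∞) (j : ℕ) (c : Fin n → ℝ) {r : ℝ}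
    (hr : 0 < r) : ∫⁻ x in Q c r, F (E g (j + 1) c r x) =
      ∑ e : Fin n → Bool, ∫⁻ x in Q (ch c r e) (r / 2), F (E g j (ch c r e) (r / 2) x) := by
  rw [lintegral_split c hr]
  refine Finset.sum_congr rfl fun e _ => ?_
  refine setLIntegral_congr_fun (measurableSet_Q _ _) fun x hx => ?_
  simp only [E, (of_mem_child hr hx).2]

section main
variable {g : (Fin n → ℝ) → ℝ} {N γ : ℝ}

lemma stepB_unstopped (hg : LocallyIntegrable g) (hN : 0 < N) (hb : Bd g N) (hγ : 0 ≤ γ)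
    (hγN : Real.exp (γ * ((2 + 2 ^ n) * N)) ≤ 3 / 2) (j : ℕ)
    (ihB : ∀ (i : ℕ), i < j → ∀ (c : Fin n → ℝ) (r : ℝ), 0 < r → ∀ a : ℝ,
      |(⨍ y in Q c r, g y) - a| ≤ (2 + 2 ^ n) * N →
      ∫⁻ x in Q c r, ENNReal.ofReal (Real.exp (γ * |E g i c r x - a|)) ≤
        ENNReal.ofReal (3 / 2) * volume (Q c r) +
          ENNReal.ofReal (9 / (2 * N)) * ∫⁻ x in Q c r, ‖g x - a‖ₑ)
    (c : Fin n → ℝ) (r : ℝ) (hr : 0 < r) (a : ℝ) (ha : |(⨍ y in Q c r, g y) - a| ≤ 2 * N) :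
    ∫⁻ x in Q c r, ENNReal.ofReal (Real.exp (γ * |E g j c r x - a|)) ≤
        ENNReal.ofReal (3 / 2) * volume (Q c r) +
          ENNReal.ofReal (9 / (2 * N)) * ∫⁻ x in Q c r, ‖g x - a‖ₑ := by
  cases j with
  | zero =>
    simp only [E]
    rw [setLIntegral_const]
    refine le_trans ?_ le_self_add
    gcongr
    refine le_trans ?_ hγN
    gcongr
    have : 0 ≤ 2 ^ n * N := by positivity
    linarith
  | succ j =>
    rw [lintegral_E_succ g (fun t => ENNReal.ofReal (Real.exp (γ * |t - a|))) j c hr]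
    have hv : volume (Q c r) = ∑ e : Fin n → Bool, volume (Q (ch c r e) (r / 2)) := by
      have := lintegral_split c hr (fun _ => 1)
      simpa using this
    rw [lintegral_split c hr (fun x => ‖g x - a‖ₑ), hv, Finset.mul_sum, Finset.mul_sum,
      ← Finset.sum_add_distrib]
    refine Finset.sum_le_sum fun e _ => ?_
    refine ihB j (Nat.lt_succ_self j) _ _ (half_pos hr) a ?_
    have h1 := avg_half hg hN.le hb hr (child_subset c hr e)
    have h2 := abs_sub_le (⨍ y in Q (ch c r e) (r / 2), g y) (⨍ y in Q c r, g y) a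
    linarith

lemma stepAB (hg : LocallyIntegrable g) (hN : 0 < N) (hb : Bd g N) (hγ : 0 ≤ γ)
    (hγN : Real.exp (γ * ((2 + 2 ^ n) * N)) ≤ 3 / 2) (j : ℕ) :
    (∀ (c : Fin n → ℝ) (r : ℝ), 0 < r →
      ∫⁻ x in Q c r, ENNReal.ofReal (Real.exp (γ * |E g j c r x - ⨍ y in Q c r, g y|)) ≤
        ENNReal.ofReal 6 * volume (Q c r)) ∧
    (∀ (c : Fin n → ℝ) (r : ℝ), 0 < r → ∀ a : ℝ,
      |(⨍ y in Q c r, g y) - a| ≤ (2 + 2 ^ n) * N →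
      ∫⁻ x in Q c r, ENNReal.ofReal (Real.exp (γ * |E g j c r x - a|)) ≤
        ENNReal.ofReal (3 / 2) * volume (Q c r) +
          ENNReal.ofReal (9 / (2 * N)) * ∫⁻ x in Q c r, ‖g x - a‖ₑ) := by
  induction j using Nat.strong_induction_on with
  | _ j ih =>
  have hU := stepB_unstopped hg hN hb hγ hγN j (fun i hi => (ih i hi).2)
  have hA : ∀ (c : Fin n → ℝ) (r : ℝ), 0 < r →
      ∫⁻ x in Q c r, ENNReal.ofReal (Real.exp (γ * |E g j c r x - ⨍ y in Q c r, g y|)) ≤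
        ENNReal.ofReal 6 * volume (Q c r) := by
    intro c r hr
    refine (hU c r hr _ (by simp; positivity)).trans ?_
    refine (add_le_add_right (mul_le_mul_right (hb c r hr) _) _).trans ?_
    rw [← mul_assoc, ← ENNReal.ofReal_mul (by positivity), ← add_mul,
      ← ENNReal.ofReal_add (by norm_num) (by positivity)]
    gcongr
    rw [show 9 / (2 * N) * N = 9 / 2 by field_simp]; norm_num
  refine ⟨hA, fun c r hr a ha => ?_⟩
  by_cases hs : |(⨍ y in Q c r, g y) - a| ≤ 2 * N
  · exact hU c r hr a hs
  · push Not at hs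
    refine le_trans ?_ le_add_self
    have h1 : ENNReal.ofReal (2 * N) * volume (Q c r) ≤ ∫⁻ x in Q c r, ‖g x - a‖ₑ :=
      le_trans (by gcongr) (avg_sub_le hg c hr a)
    calc ∫⁻ x in Q c r, ENNReal.ofReal (Real.exp (γ * |E g j c r x - a|))
        ≤ ∫⁻ x in Q c r, ENNReal.ofReal (3 / 2) *
          ENNReal.ofReal (Real.exp (γ * |E g j c r x - ⨍ y in Q c r, g y|)) := by
          refine lintegral_mono fun x => ?_
          rw [← ENNReal.ofReal_mul (by norm_num)]
          refine ENNReal.ofReal_le_ofReal ?_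
          refine le_trans ?_ (mul_le_mul_of_nonneg_right hγN (Real.exp_pos _).le)
          rw [← Real.exp_add]
          refine Real.exp_le_exp.2 ?_
          rw [← mul_add]
          refine mul_le_mul_of_nonneg_left ?_ hγ
          have h2 := abs_sub_le (E g j c r x) (⨍ y in Q c r, g y) a
          linarith
      _ = ENNReal.ofReal (3 / 2) * ∫⁻ x in Q c r,
          ENNReal.ofReal (Real.exp (γ * |E g j c r x - ⨍ y in Q c r, g y|)) :=
          lintegral_const_mul' _ _ ENNReal.ofReal_ne_top
      _ ≤ ENNReal.ofReal (3 / 2) * (ENNReal.ofReal 6 * volume (Q c r)) := by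
          gcongr; exact hA c r hr
      _ = ENNReal.ofReal (9 / (2 * N)) * (ENNReal.ofReal (2 * N) * volume (Q c r)) := by
          rw [← mul_assoc, ← mul_assoc, ← ENNReal.ofReal_mul (by norm_num),
            ← ENNReal.ofReal_mul (by positivity)]
          congr 2; field_simp; norm_num
      _ ≤ _ := by gcongr

lemma avg_Q_eq_closedBall (c : Fin n → ℝ) {r : ℝ} (hr : 0 < r) :
    ⨍ y in Q c r, g y = ⨍ y in Metric.closedBall (fun i => c i + r / 2) (r / 2), g y := by
  refine setAverage_congr ?_
  have h : Metric.closedBall (fun i => c i + r / 2) (r / 2) = Set.Icc c (fun i => c i + r) := by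
    rw [closedBall_pi _ (by positivity), ← Set.pi_univ_Icc]
    congr 1; funext i
    rw [Real.closedBall_eq_Icc]; congr 1 <;> ring
  rw [h]
  exact Measure.univ_pi_Ico_ae_eq_Icc

lemma tendsto_E (hg : LocallyIntegrable g) : ∀ᵐ x : Fin n → ℝ, ∀ c r, 0 < r → x ∈ Q c r →
    Tendsto (fun j => E g j c r x) atTop (𝓝 (g x)) := by
  filter_upwards [IsUnifLocDoublingMeasure.ae_tendsto_average (μ := volume) hg 1] with x hx c r hr hxc
  choose w hw1 hw2 using fun j => E_eq g j c r x hxc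
  have hpos : ∀ j : ℕ, 0 < r / 2 ^ j := fun j => by positivity
  have := hx (l := atTop) (fun j i => w j i + r / 2 ^ j / 2) (fun j => r / 2 ^ j / 2) ?_ ?_
  · refine this.congr fun j => ?_
    rw [hw2 j, avg_Q_eq_closedBall _ (hpos j)]
  · rw [tendsto_nhdsWithin_iff]
    constructor
    · have : Tendsto (fun j : ℕ => r / 2 * (1 / 2 : ℝ) ^ j) atTop (𝓝 (r / 2 * 0)) :=
        (tendsto_pow_atTop_nhds_zero_of_lt_one (by norm_num) (by norm_num)).const_mul _
      rw [mul_zero] at this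
      refine this.congr fun j => ?_
      rw [one_div, inv_pow]; field_simp
    · exact Eventually.of_forall fun j => half_pos (hpos j)
  · refine Eventually.of_forall fun j => ?_
    rw [one_mul, Metric.mem_closedBall, dist_pi_le_iff (half_pos (hpos j)).le]
    intro i
    have := mem_Q.1 (hw1 j) i
    rw [Real.dist_eq, abs_le]
    constructor <;> linarith

/-- John-Nirenberg, exponential form. -/
theorem john_nirenberg (hg : LocallyIntegrable g) (hN : 0 < N) (hb : Bd g N) (hγ : 0 ≤ γ)
    (hγN : Real.exp (γ * ((2 + 2 ^ n) * N)) ≤ 3 / 2) (c : Fin n → ℝ) (r : ℝ) (hr : 0 < r) :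
    ∫⁻ x in Q c r, ENNReal.ofReal (Real.exp (γ * |g x - ⨍ y in Q c r, g y|)) ≤
        ENNReal.ofReal 6 * volume (Q c r) := by
  set m := ⨍ y in Q c r, g y with hm
  have hF := lintegral_liminf_le (μ := volume.restrict (Q c r)) (u := atTop)
    (f := fun (j : ℕ) x => ENNReal.ofReal (Real.exp (γ * |E g j c r x - m|)))
    (fun j => by have := measurable_E g j c r; fun_prop)
  have h1 : ∫⁻ x in Q c r, ENNReal.ofReal (Real.exp (γ * |g x - m|)) =
      ∫⁻ x in Q c r, liminf (fun j => ENNReal.ofReal (Real.exp (γ * |E g j c r x - m|))) atTop := by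
    refine lintegral_congr_ae ?_
    filter_upwards [ae_restrict_of_ae (tendsto_E hg), ae_restrict_mem (measurableSet_Q c r)]
      with x hx hxc
    have h2 := hx c r hr hxc
    have h3 : Continuous (fun t : ℝ => ENNReal.ofReal (Real.exp (γ * |t - m|))) :=
      ENNReal.continuous_ofReal.comp (by fun_prop)
    exact ((h3.tendsto _).comp h2).liminf_eq.symm
  rw [h1]
  refine hF.trans ?_
  refine liminf_le_of_le (by isBoundedDefault) fun b hb' => ?_
  obtain ⟨j, hj⟩ := hb'.exists
  exact hj.trans ((stepAB hg hN hb hγ hγN j).1 c r hr)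

end main
section global

lemma exp_third : Real.exp (1 / 3) ≤ 3 / 2 := by
  have h := Real.add_one_le_exp (-(1 / 3) : ℝ)
  rw [Real.exp_neg] at h
  have h2 : (2 / 3 : ℝ) ≤ (Real.exp (1 / 3))⁻¹ := by linarith
  have h3 := inv_anti₀ (by norm_num) h2
  rw [inv_inv] at h3
  linarith

lemma chain {g : (Fin n → ℝ) → ℝ} {N : ℝ} (hg : LocallyIntegrable g) (hN : 0 ≤ N)
    (hb : Bd g N) (k : ℕ) :
    |(⨍ y in Q (fun _ : Fin n => -(2 : ℝ) ^ k) (2 ^ (k + 1)), g y) -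
      ⨍ y in Q (fun _ : Fin n => (0 : ℝ)) 1, g y| ≤ (k + 1) * (2 ^ n * N) := by
  induction k with
  | zero =>
    have h := avg_half hg hN hb (c := fun _ : Fin n => -(2 : ℝ) ^ 0) (c' := fun _ => 0)
      (r := 2 ^ (0 + 1)) (by norm_num) (by
        intro x hx
        rw [mem_Q] at *
        intro i
        have := hx i
        norm_num at this ⊢
        constructor <;> linarith)
    rw [abs_sub_comm]
    norm_num at h ⊢
    exact h
  | succ k ih =>
    have h := avg_half hg hN hb (c := fun _ : Fin n => -(2 : ℝ) ^ (k + 1))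
      (c' := fun _ => -(2 : ℝ) ^ k) (r := 2 ^ (k + 1 + 1)) (by positivity) (by
        intro x hx
        rw [mem_Q] at *
        intro i
        have := hx i
        have h2 : (0 : ℝ) < 2 ^ k := by positivity
        simp only [pow_succ] at this ⊢
        constructor <;> linarith)
    rw [show (2 : ℝ) ^ (k + 1 + 1) / 2 = 2 ^ (k + 1) by rw [pow_succ _ (k + 1)]; ring] at h
    rw [abs_sub_comm] at h
    have h3 := abs_sub_le (⨍ y in Q (fun _ : Fin n => -(2 : ℝ) ^ (k + 1)) (2 ^ (k + 1 + 1)), g y)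
      (⨍ y in Q (fun _ : Fin n => -(2 : ℝ) ^ k) (2 ^ (k + 1)), g y)
      (⨍ y in Q (fun _ : Fin n => (0 : ℝ)) 1, g y)
    push_cast
    linarith

lemma cube_exp {g : (Fin n → ℝ) → ℝ} {N γ : ℝ} (hg : LocallyIntegrable g) (hN : 0 < N)
    (hb : Bd g N) (hγ0 : 0 ≤ γ)
    (hγ : γ * ((2 + 2 ^ n) * (|⨍ y in Q (fun _ : Fin n => (0 : ℝ)) 1, g y| + N)) ≤ 1 / 3)
    (k : ℕ) :
    ∫⁻ x in Q (fun _ : Fin n => -(2 : ℝ) ^ k) (2 ^ (k + 1)),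
      ENNReal.ofReal (Real.exp (γ * |g x|)) ≤
        ENNReal.ofReal (12 * 2 ^ ((k + 1) * (n + 1))) := by
  set A := |⨍ y in Q (fun _ : Fin n => (0 : ℝ)) 1, g y| with hA
  have hA0 : 0 ≤ A := abs_nonneg _
  have h2n : (0 : ℝ) < 2 ^ n := by positivity
  have e1 : γ * ((2 + 2 ^ n) * N) ≤ 1 / 3 := by
    refine le_trans ?_ hγ
    gcongr; linarith
  have e2 : γ * A ≤ 1 / 3 := by
    refine le_trans ?_ hγ
    gcongr; nlinarith
  have e3 : γ * (2 ^ n * N) ≤ 1 / 3 := by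
    refine le_trans ?_ e1
    gcongr; linarith
  have hJ := john_nirenberg hg hN hb hγ0 ((Real.exp_le_exp.2 e1).trans exp_third)
    (fun _ : Fin n => -(2 : ℝ) ^ k) (2 ^ (k + 1)) (by positivity)
  have hc := chain hg hN.le hb k
  set m := ⨍ y in Q (fun _ : Fin n => -(2 : ℝ) ^ k) (2 ^ (k + 1)), g y with hm
  have hm1 : |m| ≤ A + (k + 1) * (2 ^ n * N) := by
    have := abs_sub_abs_le_abs_sub m (⨍ y in Q (fun _ : Fin n => (0 : ℝ)) 1, g y)
    linarith
  have hm2 : Real.exp (γ * |m|) ≤ 2 ^ (k + 2) := by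
    have : γ * |m| ≤ ((k + 2 : ℕ) : ℝ) * (1 / 3) := by
      calc γ * |m| ≤ γ * (A + (k + 1) * (2 ^ n * N)) := by gcongr
        _ = γ * A + (k + 1) * (γ * (2 ^ n * N)) := by ring
        _ ≤ 1 / 3 + (k + 1) * (1 / 3) := by gcongr
        _ = _ := by push_cast; ring
    refine (Real.exp_le_exp.2 this).trans ?_
    rw [Real.exp_nat_mul]
    gcongr
    linarith [exp_third]
  calc ∫⁻ x in Q (fun _ : Fin n => -(2 : ℝ) ^ k) (2 ^ (k + 1)),
        ENNReal.ofReal (Real.exp (γ * |g x|))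
      ≤ ∫⁻ x in Q (fun _ : Fin n => -(2 : ℝ) ^ k) (2 ^ (k + 1)),
        ENNReal.ofReal (2 ^ (k + 2)) * ENNReal.ofReal (Real.exp (γ * |g x - m|)) := by
        refine lintegral_mono fun x => ?_
        rw [← ENNReal.ofReal_mul (by positivity)]
        refine ENNReal.ofReal_le_ofReal ?_
        refine le_trans ?_ (mul_le_mul_of_nonneg_right hm2 (Real.exp_pos _).le)
        rw [← Real.exp_add, ← mul_add]
        refine Real.exp_le_exp.2 (mul_le_mul_of_nonneg_left ?_ hγ0)
        have := abs_sub_abs_le_abs_sub (g x) m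
        linarith
    _ = ENNReal.ofReal (2 ^ (k + 2)) * ∫⁻ x in Q (fun _ : Fin n => -(2 : ℝ) ^ k) (2 ^ (k + 1)),
        ENNReal.ofReal (Real.exp (γ * |g x - m|)) :=
        lintegral_const_mul' _ _ ENNReal.ofReal_ne_top
    _ ≤ ENNReal.ofReal (2 ^ (k + 2)) * (ENNReal.ofReal 6 * ENNReal.ofReal (2 ^ (k + 1)) ^ n) := by
        rw [volume_Q] at hJ
        gcongr
    _ = _ := by
        rw [← ENNReal.ofReal_pow (by positivity), ← ENNReal.ofReal_mul (by norm_num),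
          ← ENNReal.ofReal_mul (by positivity)]
        congr 1
        rw [← pow_mul, show (k + 1) * (n + 1) = (k + 1) * n + (k + 1) by ring, pow_add _ ((k + 1) * n)]
        ring

/-! transfer to Euclidean space -/

lemma preimage_cube (c : Fin n → ℝ) (r : ℝ) :
    (WithLp.toLp 2 : (Fin n → ℝ) → EuclideanSpace ℝ (Fin n)) ⁻¹' cube n c r = Q c r := by
  ext x
  rw [mem_Q]; rfl

lemma emb : MeasurableEmbedding (WithLp.toLp 2 : (Fin n → ℝ) → EuclideanSpace ℝ (Fin n)) :=
  (MeasurableEquiv.toLp 2 (Fin n → ℝ)).measurableEmbedding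

lemma measurableSet_cube (c : Fin n → ℝ) (r : ℝ) : MeasurableSet (cube n c r) := by
  have : cube n c r = (WithLp.ofLp : EuclideanSpace ℝ (Fin n) → (Fin n → ℝ)) ⁻¹' Q c r := by
    ext x
    rw [mem_preimage, mem_Q]; rfl
  rw [this]
  exact (PiLp.volume_preserving_ofLp (Fin n)).measurable (measurableSet_Q c r)

lemma lint_cube (c : Fin n → ℝ) (r : ℝ) (F : EuclideanSpace ℝ (Fin n) → ℝ≥0∞) :
    ∫⁻ x in cube n c r, F x = ∫⁻ y in Q c r, F (WithLp.toLp 2 y) := by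
  rw [← preimage_cube]
  exact ((PiLp.volume_preserving_toLp (Fin n)).setLIntegral_comp_preimage_emb emb F _).symm

lemma avg_cube (c : Fin n → ℝ) (r : ℝ) (F : EuclideanSpace ℝ (Fin n) → ℝ) :
    ⨍ x in cube n c r, F x = ⨍ y in Q c r, F (WithLp.toLp 2 y) := by
  rw [setAverage_eq, setAverage_eq, ← preimage_cube]
  rw [(PiLp.volume_preserving_toLp (Fin n)).setIntegral_preimage_emb emb F]
  rw [Measure.real, Measure.real, (PiLp.volume_preserving_toLp (Fin n)).measure_preimage_emb emb]

lemma locInt {g : EuclideanSpace ℝ (Fin n) → ℝ} (hg : LocallyIntegrable g) :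
    LocallyIntegrable (fun y : Fin n → ℝ => g (WithLp.toLp 2 y)) := by
  rw [locallyIntegrable_iff]
  intro K hK
  have h1 : IsCompact ((WithLp.toLp 2 : (Fin n → ℝ) → EuclideanSpace ℝ (Fin n)) '' K) :=
    hK.image (PiLp.continuous_toLp 2 _)
  have h2 := hg.integrableOn_isCompact h1
  exact ((PiLp.volume_preserving_toLp (Fin n)).integrableOn_image emb).1 h2

lemma bd_of {g : EuclideanSpace ℝ (Fin n) → ℝ} {N : ℝ} (hg : LocallyIntegrable g)
    (h : ∀ (c : Fin n → ℝ) (r : ℝ), 0 < r →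
        ⨍ x in cube n c r, |g x - ⨍ y in cube n c r, g y| ≤ N) :
    Bd (fun y : Fin n → ℝ => g (WithLp.toLp 2 y)) N := by
  intro c r hr
  have h1 := h c r hr
  rw [avg_cube c r g, avg_cube c r (fun x => |g x - _|)] at h1
  set m := ⨍ y in Q c r, g (WithLp.toLp 2 y)
  have h0 : 0 < volume.real (Q c r) :=
    ENNReal.toReal_pos (volume_Q_ne_zero c hr) (volume_Q_ne_top c r)
  have hv : volume (Q c r) = ENNReal.ofReal (volume.real (Q c r)) :=
    (ENNReal.ofReal_toReal (volume_Q_ne_top c r)).symm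
  rw [setAverage_eq, smul_eq_mul, inv_mul_le_iff₀ h0] at h1
  have hi : IntegrableOn (fun y : Fin n → ℝ => g (WithLp.toLp 2 y) - m) (Q c r) :=
    (integrableOn_Q (locInt hg) c r).sub (integrableOn_const (volume_Q_ne_top c r))
  rw [← ofReal_integral_norm_eq_lintegral_enorm hi, hv, mul_comm, ← ENNReal.ofReal_mul h0.le]
  exact ENNReal.ofReal_le_ofReal h1

lemma global_exp {g : EuclideanSpace ℝ (Fin n) → ℝ} {N γ : ℝ} (hg : LocallyIntegrable g)
    (hN : 0 < N) (h : ∀ (c : Fin n → ℝ) (r : ℝ), 0 < r →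
        ⨍ x in cube n c r, |g x - ⨍ y in cube n c r, g y| ≤ N) (hγ0 : 0 ≤ γ)
    (hγ : γ * ((2 + 2 ^ n) * (|⨍ y in cube n (fun _ => 0) 1, g y| + N)) ≤ 1 / 3) :
    ∫⁻ x, ENNReal.ofReal (Real.exp (γ * |g x|) / (Real.exp 1 + ‖x‖) ^ (n + 2)) ≤
      ENNReal.ofReal (2 ^ (n + 2) * 12 * 2 ^ (n + 1) * 2) := by
  rw [avg_cube] at hγ
  have hk := cube_exp (locInt hg) hN (bd_of hg h) hγ0 hγ
  let R : ℕ → Set (EuclideanSpace ℝ (Fin n)) := fun k => cube n (fun _ => -(2 : ℝ) ^ k) (2 ^ (k + 1))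
  have hR : ∀ k, ∫⁻ x in R k, ENNReal.ofReal (Real.exp (γ * |g x|)) ≤
      ENNReal.ofReal (12 * 2 ^ ((k + 1) * (n + 1))) := by
    intro k
    rw [lint_cube]; exact hk k
  let w : ℕ → ℝ := fun k => 2 ^ (n + 2) / (2 ^ k) ^ (n + 2)
  have hpt : ∀ x, ENNReal.ofReal (Real.exp (γ * |g x|) / (Real.exp 1 + ‖x‖) ^ (n + 2)) ≤
      ∑' k, ENNReal.ofReal (w k) *
        (R k).indicator (fun x => ENNReal.ofReal (Real.exp (γ * |g x|))) x := by
    intro x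
    have he : 1 ≤ Real.exp 1 := Real.one_le_exp (by norm_num)
    obtain ⟨k, hk1, hk2⟩ := exists_nat_pow_near (x := Real.exp 1 + ‖x‖) (y := (2 : ℝ))
      (by linarith [norm_nonneg x]) (by norm_num)
    refine le_trans ?_ (ENNReal.le_tsum (k + 1))
    have hx : x ∈ R (k + 1) := by
      intro i
      have h1 := PiLp.norm_apply_le x i
      rw [Real.norm_eq_abs] at h1
      have h2 := abs_le.1 h1
      have h3 : (2 : ℝ) ^ (k + 1 + 1) = 2 * 2 ^ (k + 1) := by rw [pow_succ]; ring
      constructor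
      · linarith
      · rw [h3]; linarith
    rw [indicator_of_mem hx, ← ENNReal.ofReal_mul (by positivity)]
    refine ENNReal.ofReal_le_ofReal ?_
    rw [div_eq_inv_mul]
    refine mul_le_mul_of_nonneg_right ?_ (Real.exp_pos _).le
    simp only [w]
    rw [← div_pow, ← inv_pow]
    refine pow_le_pow_left₀ (by positivity) ?_ _
    rw [pow_succ, inv_le_comm₀ (by positivity) (by positivity)]
    rw [inv_div]
    rw [mul_div_cancel_right₀ _ (by norm_num)]
    exact hk1
  have hme : AEMeasurable (fun x => ENNReal.ofReal (Real.exp (γ * |g x|))) := by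
    have := hg.aestronglyMeasurable.aemeasurable
    fun_prop
  calc _ ≤ ∫⁻ x, ∑' k, ENNReal.ofReal (w k) *
        (R k).indicator (fun x => ENNReal.ofReal (Real.exp (γ * |g x|))) x := lintegral_mono hpt
    _ = ∑' k, ∫⁻ x, ENNReal.ofReal (w k) *
        (R k).indicator (fun x => ENNReal.ofReal (Real.exp (γ * |g x|))) x :=
        lintegral_tsum fun k => (hme.indicator (measurableSet_cube _ _)).const_mul _
    _ ≤ ∑' k : ℕ, ENNReal.ofReal (2 ^ (n + 2) * 12 * 2 ^ (n + 1) * (1 / 2) ^ k) := by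
        refine ENNReal.tsum_le_tsum fun k => ?_
        rw [lintegral_const_mul' _ _ ENNReal.ofReal_ne_top,
          lintegral_indicator (measurableSet_cube _ _)]
        refine (mul_le_mul_right (hR k) _).trans ?_
        rw [← ENNReal.ofReal_mul (by positivity)]
        refine ENNReal.ofReal_le_ofReal (le_of_eq ?_)
        simp only [w]
        rw [one_div, inv_pow, show (k + 1) * (n + 1) = k * (n + 1) + (n + 1) by ring,
          pow_add _ (k * (n + 1)), pow_mul, pow_succ (2 ^ k) (n + 1)]
        field_simp
    _ = _ := by
        rw [← ENNReal.ofReal_tsum_of_nonneg (fun k => by positivity)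
          (summable_geometric_two.mul_left _), tsum_mul_left, tsum_geometric_two]

lemma theta_bound (x : EuclideanSpace ℝ (Fin n)) {s u : ℝ} (hs : 0 ≤ s) (hu : 0 ≤ u) :
    theta n x (s * u) ≤ 2 * (n + 2) * s + Real.exp u / (Real.exp 1 + ‖x‖) ^ (n + 2) := by
  have hx := norm_nonneg x
  have he := Real.exp_pos 1
  have he1 : 1 ≤ Real.exp 1 := Real.one_le_exp (by norm_num)
  have hsu : 0 ≤ s * u := mul_nonneg hs hu
  have hL : 1 ≤ Real.log (Real.exp 1 + ‖x‖) := by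
    rw [Real.le_log_iff_exp_le (by positivity)]; linarith
  have hL2 : 1 ≤ Real.log (Real.exp 1 + s * u) := by
    rw [Real.le_log_iff_exp_le (by positivity)]; linarith
  unfold theta
  set L := Real.log (Real.exp 1 + ‖x‖) with hLd
  set T := Real.log (Real.exp 1 + s * u) with hTd
  by_cases hc : u ≤ 2 * (n + 2) * (L + T)
  · have : s * u / (L + T) ≤ 2 * (n + 2) * s := by
      rw [div_le_iff₀ (by positivity)]
      calc s * u ≤ s * (2 * (n + 2) * (L + T)) := by gcongr
        _ = _ := by ring
    have h2 : 0 ≤ Real.exp u / (Real.exp 1 + ‖x‖) ^ (n + 2) := by positivity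
    linarith
  · push Not at hc
    have h1 : s * u / (L + T) ≤ s * u := div_le_self hsu (by linarith)
    have h2 : s * u ≤ Real.exp T := by
      rw [Real.exp_log (by positivity)]; linarith
    have h3 : (Real.exp 1 + ‖x‖) ^ (n + 2) = Real.exp ((n + 2 : ℕ) * L) := by
      rw [Real.exp_nat_mul, Real.exp_log (by positivity)]
    have h4 : s * u ≤ Real.exp u / (Real.exp 1 + ‖x‖) ^ (n + 2) := by
      rw [h3, ← Real.exp_sub]
      refine h2.trans (Real.exp_le_exp.2 ?_)
      push_cast
      have hn : (0 : ℝ) ≤ n := Nat.cast_nonneg n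
      nlinarith
    have h5 : 0 ≤ 2 * ((n : ℝ) + 2) * s := by positivity
    linarith

lemma theta_scale (x : EuclideanSpace ℝ (Fin n)) {t m : ℝ} (ht : 0 ≤ t) (hm : 1 ≤ m) :
    theta n x (t / m ^ 2) ≤ 2 / m * theta n x t := by
  have hx := norm_nonneg x
  have he := Real.exp_pos 1
  have hm0 : 0 < m := by linarith
  have hL : 1 ≤ Real.log (Real.exp 1 + ‖x‖) := by
    rw [Real.le_log_iff_exp_le (by positivity)]; linarith
  have hT : 1 ≤ Real.log (Real.exp 1 + t) := by
    rw [Real.le_log_iff_exp_le (by positivity)]; linarith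
  have htm : 0 ≤ t / m ^ 2 := by positivity
  have hS : 1 ≤ Real.log (Real.exp 1 + t / m ^ 2) := by
    rw [Real.le_log_iff_exp_le (by positivity)]; linarith
  have hST : Real.log (Real.exp 1 + t) ≤ 2 * Real.log m + Real.log (Real.exp 1 + t / m ^ 2) := by
    rw [show 2 * Real.log m = Real.log (m ^ 2) by rw [Real.log_pow]; norm_num,
      ← Real.log_mul (by positivity) (by positivity)]
    refine Real.log_le_log (by positivity) ?_
    rw [mul_add, mul_div_cancel₀ _ (by positivity)]
    have : 1 ≤ m ^ 2 := one_le_pow₀ hm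
    nlinarith
  have hlm := Real.log_le_sub_one_of_pos hm0
  unfold theta
  set L := Real.log (Real.exp 1 + ‖x‖)
  set T := Real.log (Real.exp 1 + t)
  set S := Real.log (Real.exp 1 + t / m ^ 2)
  rw [div_mul_div_comm, div_div, div_le_div_iff₀ (by positivity) (by positivity)]
  have key : L + T ≤ 2 * m * (L + S) := by nlinarith
  calc t * (m * (L + T)) ≤ t * (m * (2 * m * (L + S))) := by gcongr
    _ = _ := by ring

lemma main_est {f g : EuclideanSpace ℝ (Fin n) → ℝ} {N I γ m : ℝ} (hf : Integrable f)
    (hg : LocallyIntegrable g) (hN : 0 < N) (hI : 0 < I) (hfI : ∫ x, |f x| ≤ I)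
    (h : ∀ (c : Fin n → ℝ) (r : ℝ), 0 < r →
        ⨍ x in cube n c r, |g x - ⨍ y in cube n c r, g y| ≤ N) (hγ0 : 0 < γ)
    (hγ : γ * ((2 + 2 ^ n) * (|⨍ y in cube n (fun _ => 0) 1, g y| + N)) ≤ 1 / 3)
    (hm : 2 * (2 * (n + 2) + 2 ^ (n + 2) * 12 * 2 ^ (n + 1) * 2) ≤ m) (hm1 : 1 ≤ m) :
    ∫⁻ x, ENNReal.ofReal (theta n x (|f x * g x| / (m ^ 2 * I / γ))) ≤ 1 := by
  have hm0 : 0 < m := by linarith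
  have hpt : ∀ x, theta n x (|f x * g x| / (m ^ 2 * I / γ)) ≤
      2 / m * (2 * (n + 2) / I * |f x| +
        Real.exp (γ * |g x|) / (Real.exp 1 + ‖x‖) ^ (n + 2)) := by
    intro x
    have e : |f x * g x| / (m ^ 2 * I / γ) = (|f x| / I * (γ * |g x|)) / m ^ 2 := by
      rw [abs_mul]; field_simp
    rw [e]
    refine (theta_scale x (by positivity) hm1).trans ?_
    gcongr
    refine (theta_bound x (by positivity) (by positivity)).trans (le_of_eq ?_)
    ring
  calc _ ≤ ∫⁻ x, ENNReal.ofReal (2 / m) * (ENNReal.ofReal (2 * (n + 2) / I * |f x|) +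
        ENNReal.ofReal (Real.exp (γ * |g x|) / (Real.exp 1 + ‖x‖) ^ (n + 2))) := by
        refine lintegral_mono fun x => ?_
        refine (ENNReal.ofReal_le_ofReal (hpt x)).trans (le_of_eq ?_)
        rw [ENNReal.ofReal_mul (by positivity), ENNReal.ofReal_add (by positivity) (by positivity)]
    _ = ENNReal.ofReal (2 / m) * ((∫⁻ x, ENNReal.ofReal (2 * (n + 2) / I * |f x|)) +
        ∫⁻ x, ENNReal.ofReal (Real.exp (γ * |g x|) / (Real.exp 1 + ‖x‖) ^ (n + 2))) := by
        rw [lintegral_const_mul' _ _ ENNReal.ofReal_ne_top, lintegral_add_left']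
        have := hf.aestronglyMeasurable.aemeasurable
        fun_prop
    _ ≤ ENNReal.ofReal (2 / m) * (ENNReal.ofReal (2 * (n + 2)) +
        ENNReal.ofReal (2 ^ (n + 2) * 12 * 2 ^ (n + 1) * 2)) := by
        gcongr
        · rw [← ofReal_integral_eq_lintegral_ofReal (hf.abs.const_mul _)
            (Eventually.of_forall fun x => by positivity), integral_const_mul]
          refine ENNReal.ofReal_le_ofReal ?_
          calc 2 * ((n : ℝ) + 2) / I * ∫ x, |f x| ≤ 2 * (n + 2) / I * I := by gcongr
            _ = _ := by field_simp
        · exact global_exp hg hN h hγ0.le hγ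
    _ ≤ 1 := by
        rw [← ENNReal.ofReal_add (by positivity) (by positivity),
          ← ENNReal.ofReal_mul (by positivity), ENNReal.ofReal_le_one, div_mul_eq_mul_div,
          div_le_one hm0]
        exact hm

end global
end JN

/-- Products of `L¹` and `BMO` functions lie in `L^log`, with
`‖fg‖_{L^log} ≤ C ‖f‖_{L¹} ‖g‖_{BMO⁺}`; the `BMO` seminorm is encoded via an arbitrary
upper bound `Nb` on all cube averages of `|g - g_Q|`, and
`‖g‖_{BMO⁺} = |g_𝐐| + ‖g‖_{BMO}` with `𝐐 = [0,1)ⁿ`. -/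
theorem product_L1_BMO_in_Llog (n : ℕ) :
    ∃ C : ℝ, 0 < C ∧ ∀ (f g : EuclideanSpace ℝ (Fin n) → ℝ) (Nb : ℝ),
      Integrable f → LocallyIntegrable g → 0 ≤ Nb →
      (∀ (c : Fin n → ℝ) (r : ℝ), 0 < r →
        ⨍ x in cube n c r, |g x - ⨍ y in cube n c r, g y| ≤ Nb) →
      (∃ lam : ℝ, 0 < lam ∧
          ∫⁻ x, ENNReal.ofReal (theta n x (|f x * g x| / lam)) ≤ 1) ∧
        LlogNorm n (fun x => f x * g x) ≤
          C * (∫ x, |f x|) * (|⨍ x in cube n (fun _ => 0) 1, g x| + Nb) := by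

  classical
  set m : ℝ := 2 * (2 * (n + 2) + 2 ^ (n + 2) * 12 * 2 ^ (n + 1) * 2) with hm
  have hm1 : 1 ≤ m := by
    have h1 : (0 : ℝ) ≤ n := Nat.cast_nonneg n
    have h2 : (0 : ℝ) ≤ 2 ^ (n + 2) * 12 * 2 ^ (n + 1) * 2 := by positivity
    rw [hm]; linarith
  have hm0 : 0 < m := by linarith
  refine ⟨m ^ 2 * (3 * (2 + 2 ^ n)), by positivity, ?_⟩
  intro f g Nb hf hg hNb h
  set A := |⨍ x in cube n (fun _ => 0) 1, g x| with hA
  have hA0 : 0 ≤ A := abs_nonneg _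
  set I := ∫ x, |f x| with hI
  have hI0 : 0 ≤ I := integral_nonneg fun x => abs_nonneg _
  have key : ∀ d : ℝ, 0 < d →
      0 < m ^ 2 * (3 * (2 + 2 ^ n)) * (I + d) * (A + (Nb + d)) ∧
      ∫⁻ x, ENNReal.ofReal (theta n x
        (|f x * g x| / (m ^ 2 * (3 * (2 + 2 ^ n)) * (I + d) * (A + (Nb + d))))) ≤ 1 := by
    intro d hd
    refine ⟨by positivity, ?_⟩
    have hG : 0 < A + (Nb + d) := by positivity
    have := JN.main_est (γ := 1 / (3 * (2 + 2 ^ n) * (A + (Nb + d)))) (N := Nb + d) (I := I + d)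
      (m := m) hf hg (by positivity) (by positivity) (by linarith)
      (fun c r hr => (h c r hr).trans (by linarith)) (by positivity)
      (by rw [← hA]; apply le_of_eq; field_simp) hm.ge hm1
    convert this using 6
    field_simp
  refine ⟨⟨_, key 1 one_pos⟩, ?_⟩
  have hle : ∀ d : ℝ, 0 < d → LlogNorm n (fun x => f x * g x) ≤
      m ^ 2 * (3 * (2 + 2 ^ n)) * (I + d) * (A + (Nb + d)) := fun d hd =>
    csInf_le ⟨0, fun y hy => hy.1.le⟩ (key d hd)
  have hcont : Filter.Tendsto (fun d : ℝ => m ^ 2 * (3 * (2 + 2 ^ n)) * (I + d) * (A + (Nb + d)))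
      (nhdsWithin 0 (Set.Ioi 0)) (nhds (m ^ 2 * (3 * (2 + 2 ^ n)) * (I + 0) * (A + (Nb + 0)))) := by
    refine Filter.Tendsto.mono_left ?_ nhdsWithin_le_nhds
    exact Continuous.tendsto (by fun_prop) 0
  rw [add_zero, add_zero] at hcont
  exact ge_of_tendsto hcont (Filter.eventually_of_mem self_mem_nhdsWithin fun d hd => hle d hd)
end
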